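/- Let (ζ_n)_{n≥1} and ζ be ℝ^d-valued integrable random variables with E_P[|ζ_n − ζ|] → 0 as n → ∞, and let M^n and M be right-continuous versions of the uniformly integrable martingales M^n_t = E_P[ζ_n | F_t] and M_t = E_P[ζ | F_t]. Then there exist a subsequence (n_k) and a nondecreasing sequence (τ_m)_{m≥1} of stopping times with values in [0,∞] such that the sets {τ_m = ∞} increase to Ω as m → ∞ and, for each m ≥ 1, E_P[ sup_{t≥0} |M^{n_k}_{t∧τ_m} − M_{t∧τ_m}| ] → 0 as k → ∞. -/

import Mathlib

open MeasureTheory Filter Set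
open scoped ENNReal NNReal

noncomputable section

/-- A stopping time with values in `[0, ∞]` relative to the filtration `F`. -/
def IsStoppingTimeENN {Ω : Type*} {m : MeasurableSpace Ω}
    (F : Filtration ℝ≥0 m) (τ : Ω → ℝ≥0∞) : Prop :=
  ∀ t : ℝ≥0, MeasurableSet[F t] {ω | τ ω ≤ (t : ℝ≥0∞)}

/-- The process `M` stopped at the `[0, ∞]`-valued random time `τ`,
i.e. `t ↦ M_{t ∧ τ}`. -/
def stoppedAtENN {Ω E : Type*} (M : ℝ≥0 → Ω → E) (τ : Ω → ℝ≥0∞) : ℝ≥0 → Ω → E :=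
  fun t ω => if τ ω ≤ (t : ℝ≥0∞) then M (τ ω).toNNReal ω else M t ω


/-- Enumeration of a countable dense set of times. -/
def rq (q : ℚ) : ℝ≥0 := Real.toNNReal (q : ℝ)

lemma setLIntegral_condExp_le {Ω : Type*} {m : MeasurableSpace Ω} {P : Measure Ω}
    [IsProbabilityMeasure P] {E : Type*} [NormedAddCommGroup E] [NormedSpace ℝ E] [CompleteSpace E]
    (F : Filtration ℝ≥0 m) (ξ : Ω → E) (hξ : Integrable ξ P) (Y : Ω → E) (t : ℝ≥0)
    (hY : Y =ᵐ[P] P[ξ | F t]) (A : Set Ω) (hA : MeasurableSet[F t] A) :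
    ∫⁻ ω in A, ‖Y ω‖ₑ ∂P ≤ ∫⁻ ω in A, ‖ξ ω‖ₑ ∂P := by
  have h1 : ∀ᵐ ω ∂P, ‖Y ω‖ₑ ≤ ENNReal.ofReal ((P[fun ω => ‖ξ ω‖ | F t]) ω) := by
    filter_upwards [hY, norm_condExp_le (μ := P) (m := F t) ξ] with ω h1 h2
    rw [h1, ← ofReal_norm]
    exact ENNReal.ofReal_le_ofReal h2
  have h0 : ∀ᵐ ω ∂P, 0 ≤ (P[fun ω => ‖ξ ω‖ | F t]) ω :=
    condExp_nonneg (ae_of_all _ fun ω => norm_nonneg _)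
  calc ∫⁻ ω in A, ‖Y ω‖ₑ ∂P
      ≤ ∫⁻ ω in A, ENNReal.ofReal ((P[fun ω => ‖ξ ω‖ | F t]) ω) ∂P :=
        lintegral_mono_ae (ae_restrict_of_ae h1)
    _ = ENNReal.ofReal (∫ ω in A, (P[fun ω => ‖ξ ω‖ | F t]) ω ∂P) := by
        rw [ofReal_integral_eq_lintegral_ofReal integrable_condExp.integrableOn
          (ae_restrict_of_ae h0)]
    _ = ENNReal.ofReal (∫ ω in A, ‖ξ ω‖ ∂P) := by
        rw [setIntegral_condExp (F.le t) hξ.norm hA]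
    _ = ∫⁻ ω in A, ‖ξ ω‖ₑ ∂P := ofReal_integral_norm_eq_lintegral_enorm hξ.integrableOn

/-- Optional sampling inequality for right-continuous closed martingales. -/
lemma optional_sampling {Ω : Type*} {m : MeasurableSpace Ω} {P : Measure Ω}
    [IsProbabilityMeasure P] {E : Type*} [NormedAddCommGroup E] [NormedSpace ℝ E] [CompleteSpace E]
    (F : Filtration ℝ≥0 m) (ξ : Ω → E) (hξ : Integrable ξ P) (X : ℝ≥0 → Ω → E)
    (hX : ∀ t, X t =ᵐ[P] P[ξ | F t])
    (hrc : ∀ ω, ∀ t : ℝ≥0, ContinuousWithinAt (fun s => X s ω) (Ici t) t)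
    (τ : Ω → ℝ≥0∞) (hτ : ∀ t : ℝ≥0, MeasurableSet[F t] {ω | τ ω < t}) :
    ∫⁻ ω, (if τ ω = ∞ then 0 else ‖X (τ ω).toNNReal ω‖ₑ) ∂P ≤ ∫⁻ ω, ‖ξ ω‖ₑ ∂P := by
  classical
  set A : ℕ → ℕ → Set Ω := fun j i =>
    {ω | τ ω < (((i + 1 : ℝ≥0) / (j + 1) : ℝ≥0) : ℝ≥0∞)} \
      {ω | τ ω < (((i : ℝ≥0) / (j + 1) : ℝ≥0) : ℝ≥0∞)} with hAdef
  have hA : ∀ j i : ℕ, MeasurableSet[F ((i + 1 : ℝ≥0) / (j + 1))] (A j i) := by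
    intro j i
    refine (hτ _).diff ?_
    refine F.mono (i := (i : ℝ≥0) / (j + 1)) ?_ _ (hτ _)
    gcongr; simp
  have hA' : ∀ j i, MeasurableSet (A j i) := fun j i => F.le _ _ (hA j i)
  have hdisj : ∀ j, Pairwise (Function.onFun Disjoint (A j)) := by
    intro j
    have key : ∀ a b : ℕ, a < b → Disjoint (A j a) (A j b) := by
      intro a b hab
      rw [Set.disjoint_left]
      rintro ω ⟨h1, _⟩ ⟨_, h4⟩
      simp only [mem_ofPred_eq] at h1 h4
      apply h4
      refine lt_of_lt_of_le h1 ?_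
      rw [ENNReal.coe_le_coe]
      gcongr
      exact_mod_cast hab
    intro a b hab
    rcases lt_or_gt_of_ne hab with h | h
    · exact key a b h
    · exact (key b a h).symm
  set f : ℕ → Ω → ℝ≥0∞ := fun j ω =>
    ∑' i, (A j i).indicator (fun ω => ‖X ((i + 1 : ℝ≥0) / (j + 1)) ω‖ₑ) ω with hf
  have hXm : ∀ t, AEMeasurable (fun ω => ‖X t ω‖ₑ) P := fun t =>
    (((stronglyMeasurable_condExp.mono (F.le t)).aestronglyMeasurable).congr (hX t).symm).enorm
  have hfm : ∀ j, AEMeasurable (f j) P := fun j =>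
    AEMeasurable.tsum fun i => (hXm _).indicator (hA' j i)
  have hfle : ∀ j, ∫⁻ ω, f j ω ∂P ≤ ∫⁻ ω, ‖ξ ω‖ₑ ∂P := by
    intro j
    rw [lintegral_tsum fun i => (hXm _).indicator (hA' j i)]
    calc _ ≤ ∑' i, ∫⁻ ω in A j i, ‖ξ ω‖ₑ ∂P := by
          refine ENNReal.tsum_le_tsum fun i => ?_
          rw [lintegral_indicator (hA' j i)]
          exact setLIntegral_condExp_le F ξ hξ _ _ (hX _) _ (hA j i)
      _ = ∫⁻ ω in ⋃ i, A j i, ‖ξ ω‖ₑ ∂P := (lintegral_iUnion (hA' j) (hdisj j) _).symm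
      _ ≤ _ := setLIntegral_le_lintegral _ _
  have hlim : ∀ ω, (if τ ω = ∞ then 0 else ‖X (τ ω).toNNReal ω‖ₑ) ≤
      liminf (fun j => f j ω) atTop := by
    intro ω
    by_cases h : τ ω = ∞
    · simp [h]
    rw [if_neg h]
    set s := (τ ω).toNNReal with hs
    have hs' : τ ω = (s : ℝ≥0∞) := (ENNReal.coe_toNNReal h).symm
    set u : ℕ → ℝ≥0 := fun j => ((⌊s * (j + 1)⌋₊ : ℝ≥0) + 1) / (j + 1) with hu
    have hfu : ∀ j, f j ω = ‖X (u j) ω‖ₑ := by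
      intro j
      have hj : (0 : ℝ≥0) < j + 1 := by positivity
      have hmem : ω ∈ A j ⌊s * (j + 1)⌋₊ := by
        refine ⟨?_, ?_⟩
        · simp only [mem_ofPred_eq, hs', ENNReal.coe_lt_coe]
          rw [lt_div_iff₀ hj]
          exact Nat.lt_floor_add_one _
        · simp only [mem_ofPred_eq, hs', ENNReal.coe_lt_coe, not_lt]
          rw [div_le_iff₀ hj]
          exact Nat.floor_le (by positivity)
      simp only [hf]
      rw [tsum_eq_single ⌊s * (j + 1)⌋₊]
      · rw [indicator_of_mem hmem]
      · intro i hi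
        apply indicator_of_notMem
        intro hi'
        exact Set.disjoint_left.1 (hdisj j hi) hi' hmem
    have hule : ∀ j, s ≤ u j := by
      intro j
      have hj : (0 : ℝ≥0) < j + 1 := by positivity
      simp only [hu]
      rw [le_div_iff₀ hj]
      exact (Nat.lt_floor_add_one _).le
    have huup : ∀ j, u j ≤ s + 1 / (j + 1) := by
      intro j
      have hj : (0 : ℝ≥0) < j + 1 := by positivity
      simp only [hu]
      rw [div_le_iff₀ hj, add_mul, div_mul_cancel₀ _ hj.ne']
      gcongr
      exact Nat.floor_le (by positivity)
    have hulim : Tendsto u atTop (nhds s) := by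
      refine tendsto_of_tendsto_of_tendsto_of_le_of_le tendsto_const_nhds ?_ hule huup
      have : Tendsto (fun j : ℕ => (1 : ℝ≥0) / (j + 1)) atTop (nhds 0) :=
        tendsto_one_div_add_atTop_nhds_zero_nat
      simpa using this.const_add s
    have hulim' : Tendsto u atTop (nhdsWithin s (Ici s)) :=
      tendsto_nhdsWithin_iff.2 ⟨hulim, Eventually.of_forall hule⟩
    have h3 : Tendsto (fun j => f j ω) atTop (nhds ‖X s ω‖ₑ) := by
      simp_rw [hfu]
      exact ((hrc ω s).tendsto.comp hulim').enorm
    exact h3.liminf_eq.ge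
  calc _ ≤ ∫⁻ ω, liminf (fun j => f j ω) atTop ∂P := lintegral_mono hlim
    _ ≤ liminf (fun j => ∫⁻ ω, f j ω ∂P) atTop := lintegral_liminf_le' hfm
    _ ≤ liminf (fun j : ℕ => ∫⁻ ω, ‖ξ ω‖ₑ ∂P) atTop :=
        liminf_le_liminf (Eventually.of_forall hfle)
    _ = _ := by simp

/-- First time (along the countable dense set of times) at which `U` holds. -/
def hitQ {Ω : Type*} (U : ℝ≥0 → Ω → Prop) (ω : Ω) : ℝ≥0∞ :=
  ⨅ (q : ℚ) (_ : U (rq q) ω), (rq q : ℝ≥0∞)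

lemma hitQ_lt_iff {Ω : Type*} (U : ℝ≥0 → Ω → Prop) (ω : Ω) (b : ℝ≥0∞) :
    hitQ U ω < b ↔ ∃ q : ℚ, U (rq q) ω ∧ (rq q : ℝ≥0∞) < b := by
  simp [hitQ, iInf_lt_iff]

lemma hitQ_le {Ω : Type*} (U : ℝ≥0 → Ω → Prop) (ω : Ω) (q : ℚ) (h : U (rq q) ω) :
    hitQ U ω ≤ rq q := iInf₂_le q h

lemma exists_rq {U : ℝ≥0 → Prop} {t : ℝ≥0} (h : ∀ᶠ s in nhdsWithin t (Ici t), U s)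
    {b : ℝ≥0∞} (hb : (t : ℝ≥0∞) < b) : ∃ q : ℚ, U (rq q) ∧ (rq q : ℝ≥0∞) < b := by
  obtain ⟨b', hb1, hb2⟩ := ENNReal.lt_iff_exists_nnreal_btwn.1 hb
  rw [ENNReal.coe_lt_coe] at hb1
  obtain ⟨c, hc, hc2⟩ := (mem_nhdsGE_iff_exists_Ico_subset' hb1).1 h
  obtain ⟨q, hq0, hq1, hq2⟩ := (NNReal.lt_iff_exists_rat_btwn t (min c b')).1
    (lt_min hc hb1)
  refine ⟨q, hc2 ⟨hq1.le, hq2.trans_le (min_le_left _ _)⟩, lt_trans ?_ hb2⟩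
  rw [ENNReal.coe_lt_coe]
  exact hq2.trans_le (min_le_right _ _)

lemma hitQ_measurable {Ω : Type*} {m : MeasurableSpace Ω} (F : Filtration ℝ≥0 m)
    (U : ℝ≥0 → Ω → Prop) (hU : ∀ q : ℚ, MeasurableSet[F (rq q)] {ω | U (rq q) ω}) (t : ℝ≥0) :
    MeasurableSet[F t] {ω | hitQ U ω < t} := by
  have : {ω | hitQ U ω < t} = ⋃ (q : ℚ) (_ : rq q < t), {ω | U (rq q) ω} := by
    ext ω
    simp [hitQ_lt_iff, and_comm]
  rw [this]
  exact MeasurableSet.iUnion fun q => MeasurableSet.iUnion fun hq => F.mono hq.le _ (hU q)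

lemma isStoppingTimeENN_of_lt {Ω : Type*} {m : MeasurableSpace Ω} (F : Filtration ℝ≥0 m)
    (hright : ∀ t : ℝ≥0, (F t : MeasurableSpace Ω) = ⨅ (s : ℝ≥0) (_ : t < s), F s)
    (τ : Ω → ℝ≥0∞) (hτ : ∀ t : ℝ≥0, MeasurableSet[F t] {ω | τ ω < t}) :
    IsStoppingTimeENN F τ := by
  intro t
  rw [hright t]
  simp only [MeasurableSpace.measurableSet_iInf]
  intro s hs
  obtain ⟨u, hu, hu2, hu3⟩ := exists_seq_strictAnti_tendsto' hs
  have : {ω | τ ω ≤ (t : ℝ≥0∞)} = ⋂ n, {ω | τ ω < (u n : ℝ≥0∞)} := by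
    ext ω
    simp only [mem_ofPred_eq, mem_iInter]
    constructor
    · intro h n
      exact h.trans_lt (ENNReal.coe_lt_coe.2 (hu2 n).1)
    · intro h
      exact ge_of_tendsto' (ENNReal.tendsto_coe.2 hu3) fun n => (h n).le
  rw [this]
  exact MeasurableSet.iInter fun n => F.mono (hu2 n).2.le _ (hτ _)

/-- Weak maximal inequality. -/
lemma maximal_ineq {Ω : Type*} {m : MeasurableSpace Ω} {P : Measure Ω}
    [IsProbabilityMeasure P] {E : Type*} [NormedAddCommGroup E] [NormedSpace ℝ E] [CompleteSpace E]
    (F : Filtration ℝ≥0 m) (ξ : Ω → E) (hξ : Integrable ξ P) (X : ℝ≥0 → Ω → E)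
    (hX : ∀ t, X t =ᵐ[P] P[ξ | F t])
    (hrc : ∀ ω, ∀ t : ℝ≥0, ContinuousWithinAt (fun s => X s ω) (Ici t) t)
    (hXm : ∀ q : ℚ, StronglyMeasurable[F (rq q)] (X (rq q))) (c : ℝ≥0∞) :
    c * P {ω | ∃ q : ℚ, c < ‖X (rq q) ω‖ₑ} ≤ ∫⁻ ω, ‖ξ ω‖ₑ ∂P := by
  set U : ℝ≥0 → Ω → Prop := fun t ω => c < ‖X t ω‖ₑ with hU
  have hUm : ∀ q : ℚ, MeasurableSet[F (rq q)] {ω | U (rq q) ω} := fun q =>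
    (hXm q).enorm (measurableSet_Ioi (a := c))
  have hm : MeasurableSet {ω | ∃ q : ℚ, c < ‖X (rq q) ω‖ₑ} := by
    rw [ofPred_exists]
    exact MeasurableSet.iUnion fun q => F.le _ _ (hUm q)
  refine le_trans ?_ (optional_sampling F ξ hξ X hX hrc (hitQ U) (hitQ_measurable F U hUm))
  rw [← lintegral_indicator_const hm]
  refine lintegral_mono fun ω => ?_
  by_cases hω : ω ∈ {ω | ∃ q : ℚ, c < ‖X (rq q) ω‖ₑ}
  swap
  · rw [indicator_of_notMem hω]; exact zero_le
  rw [indicator_of_mem hω]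
  obtain ⟨q, hq⟩ := hω
  have hfin : hitQ U ω ≠ ∞ := ((hitQ_le U ω q hq).trans_lt ENNReal.coe_lt_top).ne
  rw [if_neg hfin]
  set s := (hitQ U ω).toNNReal with hs
  have hs' : hitQ U ω = (s : ℝ≥0∞) := (ENNReal.coe_toNNReal hfin).symm
  by_contra! hlt
  have hev : ∀ᶠ r in nhdsWithin s (Ici s), ‖X r ω‖ₑ < c :=
    (hrc ω s).tendsto.enorm.eventually (gt_mem_nhds hlt)
  obtain ⟨b, hb, hb2⟩ := mem_nhdsGE_iff_exists_Ico_subset.1 hev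
  obtain ⟨q, hq1, hq2⟩ := (hitQ_lt_iff U ω b).1 (by rw [hs']; exact ENNReal.coe_lt_coe.2 hb)
  have hge := hitQ_le U ω q hq1
  rw [hs', ENNReal.coe_le_coe] at hge
  have := hb2 ⟨hge, ENNReal.coe_lt_coe.1 hq2⟩
  exact lt_asymm this hq1

lemma core {Ω : Type*} {m : MeasurableSpace Ω} {P : Measure Ω}
    [IsProbabilityMeasure P] {E : Type*} [NormedAddCommGroup E] [NormedSpace ℝ E] [CompleteSpace E]
    (F : Filtration ℝ≥0 m)
    (hright : ∀ t : ℝ≥0, (F t : MeasurableSpace Ω) = ⨅ (s : ℝ≥0) (_ : t < s), F s)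
    (hcomplete : ∀ s : Set Ω, MeasurableSet[m] s → P s = 0 → MeasurableSet[F 0] s)
    (ξ : ℕ → Ω → E) (hξ : ∀ k, Integrable (ξ k) P) (X : ℕ → ℝ≥0 → Ω → E)
    (hX : ∀ k t, X k t =ᵐ[P] P[ξ k | F t])
    (hrc : ∀ k, ∀ ω, ∀ t : ℝ≥0, ContinuousWithinAt (fun s => X k s ω) (Ici t) t)
    (hXm : ∀ k, ∀ q : ℚ, StronglyMeasurable[F (rq q)] (X k (rq q)))
    (hsum : ∑' k, ∫⁻ ω, ‖ξ k ω‖ₑ ∂P ≠ ∞) :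
    ∃ τ : ℕ → Ω → ℝ≥0∞,
        (∀ n, IsStoppingTimeENN F (τ n)) ∧
        (∀ ω, Monotone fun n => τ n ω) ∧
        (∀ ω, ∃ n, τ n ω = ∞) ∧
        ∀ n, Tendsto
          (fun k => ∫⁻ ω, ⨆ t : ℝ≥0, ‖stoppedAtENN (X k) (τ n) t ω‖ₑ ∂P)
          atTop (nhds 0) := by
  set a : ℕ → ℝ≥0∞ := fun k => ∫⁻ ω, ‖ξ k ω‖ₑ ∂P with ha
  have hmax : ∀ k (c : ℝ≥0∞), c * P {ω | ∃ q : ℚ, c < ‖X k (rq q) ω‖ₑ} ≤ a k := fun k c =>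
    maximal_ineq F (ξ k) (hξ k) (X k) (hX k) (hrc k) (hXm k) c
  have hm1 : ∀ k (c : ℝ≥0∞) (q : ℚ), MeasurableSet[F (rq q)] {ω | c < ‖X k (rq q) ω‖ₑ} :=
    fun k c q => (hXm k q).enorm (measurableSet_Ioi (a := c))
  have hm2 : ∀ k (c : ℝ≥0∞), MeasurableSet {ω | ∃ q : ℚ, c < ‖X k (rq q) ω‖ₑ} := by
    intro k c
    rw [ofPred_exists]
    exact MeasurableSet.iUnion fun q => F.le _ _ (hm1 k c q)
  set C : ℝ≥0∞ → Set Ω := fun c => ⋃ k, {ω | ∃ q : ℚ, c < ‖X k (rq q) ω‖ₑ} with hC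
  have hCm : ∀ c, MeasurableSet (C c) := fun c => MeasurableSet.iUnion fun k => hm2 k c
  set B : Set Ω := ⋂ n : ℕ, C n with hB
  have hBm : MeasurableSet B := MeasurableSet.iInter fun n => hCm n
  have hBle : ∀ n : ℕ, (n : ℝ≥0∞) * P B ≤ ∑' k, a k := by
    intro n
    calc (n : ℝ≥0∞) * P B ≤ n * P (C n) := by gcongr; exact iInter_subset _ n
      _ ≤ n * ∑' k, P {ω | ∃ q : ℚ, (n : ℝ≥0∞) < ‖X k (rq q) ω‖ₑ} := by
          gcongr; exact measure_iUnion_le _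
      _ = ∑' k, n * P {ω | ∃ q : ℚ, (n : ℝ≥0∞) < ‖X k (rq q) ω‖ₑ} := ENNReal.tsum_mul_left.symm
      _ ≤ _ := ENNReal.tsum_le_tsum fun k => hmax k n
  have hB0 : P B = 0 := by
    by_contra h0
    obtain ⟨n, hn⟩ := ENNReal.exists_nat_mul_gt h0 hsum
    exact absurd (hBle n) (not_le.2 hn)
  have hBF : ∀ t, MeasurableSet[F t] B := fun t => F.mono (zero_le) _ (hcomplete B hBm hB0)
  set U : ℕ → ℝ≥0 → Ω → Prop := fun n t ω => ω ∉ B ∧ ∃ k, (n : ℝ≥0∞) < ‖X k t ω‖ₑ with hU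
  have hUm : ∀ n, ∀ q : ℚ, MeasurableSet[F (rq q)] {ω | U n (rq q) ω} := by
    intro n q
    have : {ω | U n (rq q) ω} = Bᶜ ∩ ⋃ k, {ω | (n : ℝ≥0∞) < ‖X k (rq q) ω‖ₑ} := by
      ext ω; simp [hU]
    rw [this]
    exact (hBF _).compl.inter (MeasurableSet.iUnion fun k => hm1 k n q)
  have hτlt := fun n => hitQ_measurable F (U n) (hUm n)
  refine ⟨fun n => hitQ (U n), fun n => isStoppingTimeENN_of_lt F hright _ (hτlt n), ?_, ?_, ?_⟩
  · intro ω n n' hn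
    refine le_iInf₂ fun q hq => hitQ_le (U n) ω q ⟨hq.1, ?_⟩
    obtain ⟨k, hk⟩ := hq.2
    exact ⟨k, lt_of_le_of_lt (by exact_mod_cast hn) hk⟩
  · intro ω
    by_cases hω : ω ∈ B
    · refine ⟨0, ?_⟩
      simp [hitQ, hU, hω]
    · have hω' := hω
      simp only [hB, mem_iInter, not_forall] at hω'
      obtain ⟨n, hn⟩ := hω'
      refine ⟨n, ?_⟩
      simp only [hitQ, iInf_eq_top]
      rintro q ⟨_, k, hk⟩
      exact absurd (by simp only [hC, mem_iUnion]; exact ⟨k, q, hk⟩) hn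
  intro n
  have hbound : ∀ k (ε : ℝ≥0∞), ε ≠ 0 → ε ≠ ∞ →
      ∫⁻ ω, ⨆ t : ℝ≥0, ‖stoppedAtENN (X k) (hitQ (U n)) t ω‖ₑ ∂P ≤
        ε + n * (a k / ε) + a k := by
    intro k ε hε0 hεt
    set G : Set Ω := {ω | ∃ q : ℚ, ε < ‖X k (rq q) ω‖ₑ} with hG
    have hpt : ∀ᵐ ω ∂P, ⨆ t : ℝ≥0, ‖stoppedAtENN (X k) (hitQ (U n)) t ω‖ₑ ≤
        (ε + G.indicator (fun _ => (n : ℝ≥0∞)) ω) +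
          (if hitQ (U n) ω = ∞ then 0 else ‖X k (hitQ (U n) ω).toNNReal ω‖ₑ) := by
      have hBae : ∀ᵐ ω ∂P, ω ∉ B := measure_eq_zero_iff_ae_notMem.1 hB0
      filter_upwards [hBae] with ω hω
      refine iSup_le fun t => ?_
      unfold stoppedAtENN
      split_ifs with h1 h2 h2
      · exact absurd (h2 ▸ h1) (by simp)
      · exact le_add_self
      all_goals
        refine le_trans ?_ le_self_add
        by_cases hGω : ω ∈ G
        · rw [indicator_of_mem hGω]
          refine le_trans ?_ le_add_self
          by_contra! hlt
          have hev : ∀ᶠ r in nhdsWithin t (Ici t), U n r ω := by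
            filter_upwards [(hrc k ω t).tendsto.enorm.eventually (lt_mem_nhds hlt)] with r hr
            exact ⟨hω, k, hr⟩
          obtain ⟨q, hq1, hq2⟩ := exists_rq hev (not_le.1 h1)
          exact absurd (hitQ_le (U n) ω q hq1) (not_le.2 hq2)
        · refine le_trans ?_ le_self_add
          by_contra! hlt
          obtain ⟨q, hq1, -⟩ := exists_rq (U := fun r => ε < ‖X k r ω‖ₑ)
            ((hrc k ω t).tendsto.enorm.eventually (lt_mem_nhds hlt)) (ENNReal.coe_lt_top (r := t))
          exact hGω ⟨q, hq1⟩
    refine (lintegral_mono_ae hpt).trans ?_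
    have hGm : MeasurableSet G := hm2 k ε
    have hmeas : Measurable fun ω => ε + G.indicator (fun _ => (n : ℝ≥0∞)) ω :=
      measurable_const.add (measurable_const.indicator hGm)
    rw [lintegral_add_left hmeas,
      lintegral_add_left measurable_const, lintegral_indicator_const hGm, lintegral_const,
      measure_univ, mul_one]
    have hPG : P G ≤ a k / ε := by
      rw [ENNReal.le_div_iff_mul_le (Or.inl hε0) (Or.inl hεt), mul_comm]
      exact hmax k ε
    gcongr
    exact optional_sampling F (ξ k) (hξ k) (X k) (hX k) (hrc k) _ (hτlt n)
  have ha0 : Tendsto a atTop (nhds 0) := ENNReal.tendsto_atTop_zero_of_tsum_ne_top hsum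
  rw [ENNReal.tendsto_nhds_zero]
  intro δ hδ
  obtain ⟨ε, hε0, hε⟩ := ENNReal.lt_iff_exists_nnreal_btwn.1 hδ
  have hε0' : (ε : ℝ≥0∞) ≠ 0 := hε0.ne'
  have hlim : Tendsto (fun k => (ε : ℝ≥0∞) + n * (a k / ε) + a k) atTop (nhds ε) := by
    have h1 : Tendsto (fun k => a k / ε) atTop (nhds 0) := by
      simpa using ENNReal.Tendsto.div_const ha0 (Or.inr hε0')
    have h2 : Tendsto (fun k => (n : ℝ≥0∞) * (a k / ε)) atTop (nhds 0) := by
      simpa using ENNReal.Tendsto.const_mul h1 (Or.inr (ENNReal.natCast_ne_top n))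
    simpa using (h2.const_add (ε : ℝ≥0∞)).add ha0
  filter_upwards [hlim.eventually (gt_mem_nhds hε)] with k hk
  exact (hbound k ε hε0' ENNReal.coe_ne_top).trans hk.le

theorem subsequence_converges_in_H1loc
    {Ω : Type*} {m : MeasurableSpace Ω} {P : Measure Ω} [IsProbabilityMeasure P]
    (F : Filtration ℝ≥0 m)
    -- usual conditions
    (hright : ∀ t : ℝ≥0, (F t : MeasurableSpace Ω) = ⨅ (s : ℝ≥0) (_ : t < s), F s)
    (hcomplete : ∀ s : Set Ω, MeasurableSet[m] s → P s = 0 → MeasurableSet[F 0] s)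
    {d : ℕ}
    -- the terminal values `ζ_n` and `ζ`, with `E_P[|ζ_n − ζ|] → 0`
    (ζ : ℕ → Ω → EuclideanSpace ℝ (Fin d)) (ζ₀ : Ω → EuclideanSpace ℝ (Fin d))
    (hζint : ∀ n, Integrable (ζ n) P) (hζ₀int : Integrable ζ₀ P)
    (hL1conv : Tendsto (fun n => ∫ ω, ‖ζ n ω - ζ₀ ω‖ ∂P) atTop (nhds 0))
    -- `M^n` and `M` are right-continuous versions of the martingales
    -- `t ↦ E_P[ζ_n | F t]` and `t ↦ E_P[ζ | F t]`
    (M : ℕ → ℝ≥0 → Ω → EuclideanSpace ℝ (Fin d))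
    (M₀ : ℝ≥0 → Ω → EuclideanSpace ℝ (Fin d))
    (hMver : ∀ n, ∀ t : ℝ≥0, M n t =ᵐ[P] P[ζ n | F t])
    (hM₀ver : ∀ t : ℝ≥0, M₀ t =ᵐ[P] P[ζ₀ | F t])
    (hMrc : ∀ n, ∀ ω, ∀ t : ℝ≥0, ContinuousWithinAt (fun s => M n s ω) (Ici t) t)
    (hM₀rc : ∀ ω, ∀ t : ℝ≥0, ContinuousWithinAt (fun s => M₀ s ω) (Ici t) t) :
    -- there are a subsequence `(n_k)` and stopping times `τ_m ↑ ∞` with `{τ_m = ∞} ↑ Ω` such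
    -- that, for each `m`, `E_P[ sup_t |M^{n_k}_{t ∧ τ_m} − M_{t ∧ τ_m}| ] → 0` as `k → ∞`
    ∃ φ : ℕ → ℕ, StrictMono φ ∧
      ∃ τ : ℕ → Ω → ℝ≥0∞,
        (∀ n, IsStoppingTimeENN F (τ n)) ∧
        (∀ ω, Monotone fun n => τ n ω) ∧
        (∀ ω, ∃ n, τ n ω = ∞) ∧
        ∀ n, Tendsto
          (fun k => ∫⁻ ω, ⨆ t : ℝ≥0,
            (‖stoppedAtENN (M (φ k)) (τ n) t ω - stoppedAtENN M₀ (τ n) t ω‖₊ : ℝ≥0∞) ∂P)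
          atTop (nhds 0) := by
  classical
  -- a measurable null set outside of which the versions agree with the conditional expectations
  -- at all times of the countable dense set
  have hae : ∀ᵐ ω ∂P, (∀ n, ∀ q : ℚ, M n (rq q) ω = (P[ζ n | F (rq q)]) ω) ∧
      ∀ q : ℚ, M₀ (rq q) ω = (P[ζ₀ | F (rq q)]) ω := by
    refine Eventually.and ?_ ?_
    · rw [ae_all_iff]; intro n; rw [ae_all_iff]; intro q; exact hMver n _
    · rw [ae_all_iff]; intro q; exact hM₀ver _
  obtain ⟨N, hNsub, hNm, hN0⟩ := exists_measurable_superset_of_null (ae_iff.1 hae)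
  have hNgood : ∀ ω, ω ∉ N → (∀ n, ∀ q : ℚ, M n (rq q) ω = (P[ζ n | F (rq q)]) ω) ∧
      ∀ q : ℚ, M₀ (rq q) ω = (P[ζ₀ | F (rq q)]) ω := by
    intro ω hω
    by_contra h
    exact hω (hNsub h)
  have hNF : ∀ t, MeasurableSet[F t] N := fun t => F.mono zero_le _ (hcomplete N hNm hN0)
  have hNae : ∀ᵐ ω ∂P, ω ∉ N := measure_eq_zero_iff_ae_notMem.1 hN0
  -- the subsequence
  have ha0 : Tendsto (fun n => ∫⁻ ω, ‖ζ n ω - ζ₀ ω‖ₑ ∂P) atTop (nhds 0) := by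
    have h := ENNReal.tendsto_ofReal hL1conv
    rw [ENNReal.ofReal_zero] at h
    refine h.congr fun n => ?_
    exact ofReal_integral_norm_eq_lintegral_enorm ((hζint n).sub hζ₀int)
  have hev : ∀ k : ℕ, ∀ᶠ n in atTop, ∫⁻ ω, ‖ζ n ω - ζ₀ ω‖ₑ ∂P ≤ (2⁻¹ : ℝ≥0∞) ^ k := by
    intro k
    exact (ENNReal.tendsto_nhds_zero.1 ha0) _ (ENNReal.pow_pos (by simp) k)
  obtain ⟨φ, hφ, hφ2⟩ := extraction_forall_of_eventually hev
  refine ⟨φ, hφ, ?_⟩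
  set ξ : ℕ → Ω → EuclideanSpace ℝ (Fin d) := fun k => ζ (φ k) - ζ₀ with hξdef
  set X : ℕ → ℝ≥0 → Ω → EuclideanSpace ℝ (Fin d) := fun k t =>
    Nᶜ.indicator (fun ω => M (φ k) t ω - M₀ t ω) with hXdef
  have hsum : ∑' k, ∫⁻ ω, ‖ξ k ω‖ₑ ∂P ≠ ∞ := by
    have : ∑' k, ∫⁻ ω, ‖ξ k ω‖ₑ ∂P ≤ ∑' k : ℕ, (2⁻¹ : ℝ≥0∞) ^ k :=
      ENNReal.tsum_le_tsum hφ2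
    refine ne_top_of_le_ne_top ?_ this
    rw [ENNReal.tsum_geometric]
    simp
  have hX : ∀ k t, X k t =ᵐ[P] P[ξ k | F t] := by
    intro k t
    filter_upwards [hNae, hMver (φ k) t, hM₀ver t, condExp_sub (hζint (φ k)) hζ₀int (F t)]
      with ω h1 h2 h3 h4
    simp only [hXdef, hξdef]
    rw [h4, indicator_of_mem (by simpa using h1), h2, h3, Pi.sub_apply]
  have hrc : ∀ k, ∀ ω, ∀ t : ℝ≥0, ContinuousWithinAt (fun s => X k s ω) (Ici t) t := by
    intro k ω t
    by_cases hω : ω ∈ N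
    · simp only [hXdef, indicator, mem_compl_iff, hω, not_true_eq_false, if_false]
      exact continuousWithinAt_const
    · simp only [hXdef, indicator, mem_compl_iff, hω, not_false_eq_true, if_true]
      exact (hMrc (φ k) ω t).sub (hM₀rc ω t)
  have hXm : ∀ k, ∀ q : ℚ, StronglyMeasurable[F (rq q)] (X k (rq q)) := by
    intro k q
    have : X k (rq q) = Nᶜ.indicator (P[ζ (φ k) | F (rq q)] - P[ζ₀ | F (rq q)]) := by
      ext1 ω
      by_cases hω : ω ∈ N
      · simp [hXdef, hω]
      · simp [hXdef, hω, (hNgood ω hω).1, (hNgood ω hω).2]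
    rw [this]
    exact (stronglyMeasurable_condExp.sub stronglyMeasurable_condExp).indicator (hNF _).compl
  obtain ⟨τ, h1, h2, h3, h4⟩ := core F hright hcomplete ξ (fun k => (hζint (φ k)).sub hζ₀int)
    X hX hrc hXm hsum
  refine ⟨τ, h1, h2, h3, fun n => (h4 n).congr fun k => ?_⟩
  refine lintegral_congr_ae ?_
  filter_upwards [hNae] with ω hω
  refine iSup_congr fun t => ?_
  unfold stoppedAtENN
  split_ifs <;> simp [hXdef, hω, enorm_eq_nnnorm]
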